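/- Under the stated setup, there do not exist a D-pair S_u, a D-pair S_v and an A-pair S_w, pairwise distinct, such that uv ∈ E(G) and uw ∈ E(G). -/

import Mathlib

open Finset

/-- `m` encodes a perfect matching of the induced subgraph `G[S]`:
every vertex of `S` is matched to a distinct adjacent vertex of `S`. -/
def IsMatchingOn {V : Type*} (G : SimpleGraph V) (S : Finset V) (m : V → V) : Prop :=
  ∀ u ∈ S, m u ∈ S ∧ m u ≠ u ∧ G.Adj u (m u) ∧ m (m u) = u

/-- `S` is a paired dominating set of `G`: a dominating set such that `G[S]`
has a perfect matching. -/
def IsPDS {V : Type*} (G : SimpleGraph V) (S : Finset V) : Prop :=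
  (∀ v : V, v ∉ S → ∃ u ∈ S, G.Adj v u) ∧ ∃ m : V → V, IsMatchingOn G S m

/-- The paired domination number of `G`. -/
noncomputable def gammaPr {V : Type*} (G : SimpleGraph V) : ℕ :=
  sInf {k : ℕ | ∃ S : Finset V, IsPDS G S ∧ S.card = k}

/-- `N_S(x)`, the set of neighbours of `x` inside `S`. -/
def nbrS {V : Type*} [DecidableEq V] (G : SimpleGraph V) [DecidableRel G.Adj]
    (S : Finset V) (x : V) : Finset V :=
  S.filter (fun u => G.Adj x u)

/-- `λ(S)`: (twice) the number of edges of `G[S]` (each edge counted in both directions). -/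
def lambdaS {V : Type*} [DecidableEq V] (G : SimpleGraph V) [DecidableRel G.Adj]
    (S : Finset V) : ℕ :=
  ((S ×ˢ S).filter (fun p => G.Adj p.1 p.2)).card

/-- The private neighbours of `u ∈ S`: vertices outside `S` whose unique
neighbour in `S` is `u`. -/
def privates {V : Type*} [Fintype V] [DecidableEq V] (G : SimpleGraph V) [DecidableRel G.Adj]
    (S : Finset V) (u : V) : Finset V :=
  Finset.univ.filter (fun x => x ∉ S ∧ nbrS G S x = {u})

/-- `A = {v ∈ S : v and v̄ together have at least two private neighbours}`. -/
def setA {V : Type*} [Fintype V] [DecidableEq V] (G : SimpleGraph V) [DecidableRel G.Adj]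
    (S : Finset V) (m : V → V) : Finset V :=
  S.filter (fun v => 2 ≤ (privates G S v).card + (privates G S (m v)).card)

/-- `B = {v ∈ S : v has a private neighbour and v̄ has none}`. -/
def setB {V : Type*} [Fintype V] [DecidableEq V] (G : SimpleGraph V) [DecidableRel G.Adj]
    (S : Finset V) (m : V → V) : Finset V :=
  S.filter (fun v => (privates G S v).Nonempty ∧ privates G S (m v) = ∅)

/-- `C = {v ∈ S : v̄ ∈ B}`. -/
def setC {V : Type*} [Fintype V] [DecidableEq V] (G : SimpleGraph V) [DecidableRel G.Adj]
    (S : Finset V) (m : V → V) : Finset V :=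
  S.filter (fun v => m v ∈ setB G S m)

/-- `D = {v ∈ S : neither v nor v̄ has a private neighbour}`. -/
def setD {V : Type*} [Fintype V] [DecidableEq V] (G : SimpleGraph V) [DecidableRel G.Adj]
    (S : Finset V) (m : V → V) : Finset V :=
  S.filter (fun v => privates G S v = ∅ ∧ privates G S (m v) = ∅)

/-- The weight `f(xu)` of an edge `xu` with `x ∈ V∖S` and `u ∈ S`
(`0` on non-edges and on pairs not of this form). -/
def fwt {V : Type*} [Fintype V] [DecidableEq V] (G : SimpleGraph V) [DecidableRel G.Adj]
    (S : Finset V) (m : V → V) (x u : V) : ℚ :=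
  if x ∈ S ∨ u ∉ S ∨ ¬ G.Adj x u then 0
  else if nbrS G S x = {u} then 1
  else if nbrS G S x ⊆ setA G S m ∨ nbrS G S x ⊆ setB G S m ∪ setC G S m ∨
      nbrS G S x ⊆ setD G S m then
    1 / ((nbrS G S x).card : ℚ)
  else if u ∈ setA G S m then 0
  else if nbrS G S x ∩ setD G S m = ∅ then
    1 / (((nbrS G S x ∩ (setB G S m ∪ setC G S m))).card : ℚ)
  else if u ∈ setB G S m ∪ setC G S m then 1 / 6
  else (1 - ((nbrS G S x ∩ (setB G S m ∪ setC G S m)).card : ℚ) / 6) /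
      ((nbrS G S x ∩ setD G S m).card : ℚ)

/-- `f(S')`: total weight of the edges between `S' ⊆ S` and `V∖S`. -/
def fsum {V : Type*} [Fintype V] [DecidableEq V] (G : SimpleGraph V) [DecidableRel G.Adj]
    (S : Finset V) (m : V → V) (T : Finset V) : ℚ :=
  ∑ u ∈ T, ∑ x ∈ Finset.univ \ S, fwt G S m x u

/-- `C` is (the vertex set of) a connected component of `G[S]`. -/
def IsComponent {V : Type*} [DecidableEq V] (G : SimpleGraph V) [DecidableRel G.Adj]
    (S C : Finset V) : Prop :=
  C ⊆ S ∧ C.Nonempty ∧ (G.induce (↑C : Set V)).Connected ∧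
    ∀ u ∈ C, ∀ v ∈ S, G.Adj u v → v ∈ C

/-- `S_u = {u, m u}` is a `D`-pair. -/
def IsDPair {V : Type*} [Fintype V] [DecidableEq V] (G : SimpleGraph V) [DecidableRel G.Adj]
    (S : Finset V) (m : V → V) (u : V) : Prop :=
  u ∈ setD G S m ∧ m u ∈ setD G S m

/-- `S_u = {u, m u}` is an `A`-pair. -/
def IsAPair {V : Type*} [Fintype V] [DecidableEq V] (G : SimpleGraph V) [DecidableRel G.Adj]
    (S : Finset V) (m : V → V) (u : V) : Prop :=
  u ∈ setA G S m ∧ m u ∈ setA G S m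

/-- `S_u = {u, m u}` is a `BC`-pair. -/
def IsBCPair {V : Type*} [Fintype V] [DecidableEq V] (G : SimpleGraph V) [DecidableRel G.Adj]
    (S : Finset V) (m : V → V) (u : V) : Prop :=
  (u ∈ setB G S m ∧ m u ∈ setC G S m) ∨ (u ∈ setC G S m ∧ m u ∈ setB G S m)

/-- `u` is a leaf of `G[S]`: it has exactly one neighbour in `S`. -/
def IsLeaf {V : Type*} [DecidableEq V] (G : SimpleGraph V) [DecidableRel G.Adj]
    (S : Finset V) (u : V) : Prop :=
  (nbrS G S u).card = 1

/-- `S_u` is a solo pair: both `u` and `m u` are leaves of `G[S]`. -/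
def IsSoloPair {V : Type*} [DecidableEq V] (G : SimpleGraph V) [DecidableRel G.Adj]
    (S : Finset V) (m : V → V) (u : V) : Prop :=
  IsLeaf G S u ∧ IsLeaf G S (m u)

/-- The component `C` of `G[S]` contains no linked `D`-pairs: no edge of `G[S]`
joins vertices of two distinct `D`-pairs. -/
def NoLinkedDPairs {V : Type*} [Fintype V] [DecidableEq V] (G : SimpleGraph V)
    [DecidableRel G.Adj] (S : Finset V) (m : V → V) (C : Finset V) : Prop :=
  ∀ u ∈ C, ∀ v ∈ C, u ∈ setD G S m → v ∈ setD G S m → v ≠ u → v ≠ m u → ¬ G.Adj u v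

/-- `{w₁, w₂}` is a constraint pair of the solo `D`-pair `S_u`. -/
def ConstraintPair {V : Type*} [Fintype V] [DecidableEq V] (G : SimpleGraph V)
    [DecidableRel G.Adj] (S : Finset V) (m : V → V) (u w₁ w₂ : V) : Prop :=
  ∃ x y : V, x ∉ S ∧ y ∉ S ∧ G.Adj u y ∧ G.Adj (m u) x ∧
    G.Adj x w₁ ∧ G.Adj y w₂ ∧ w₁ ∈ setD G S m ∧ w₂ ∈ setD G S m ∧
    w₁ ≠ w₂ ∧ m w₁ ≠ w₂

/-- The pairs `S_u` and `S_v` are adjacent: some vertex of one is adjacent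
to some vertex of the other. -/
def PairAdj {V : Type*} (G : SimpleGraph V) (m : V → V) (u v : V) : Prop :=
  G.Adj u v ∨ G.Adj u (m v) ∨ G.Adj (m u) v ∨ G.Adj (m u) (m v)

/-- The Petersen graph, as the Kneser graph on 2-element subsets of a
5-element set, two subsets being adjacent iff they are disjoint. -/
def petersenGraph : SimpleGraph {s : Finset (Fin 5) // s.card = 2} where
  Adj a b := Disjoint (a : Finset (Fin 5)) (b : Finset (Fin 5))
  symm := ⟨fun _ _ h => h.symm⟩
  loopless := by
    refine ⟨?_⟩
    intro a h
    rw [disjoint_self] at h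
    have h2 := a.2
    rw [h] at h2
    simp at h2

/-- Adding a vertex `q` to `T` adds `2 |N_T(q)|` to the directed edge count. -/
theorem lambdaS_insert_aux {V : Type*} [DecidableEq V] (G : SimpleGraph V) [DecidableRel G.Adj]
    (T : Finset V) (q : V) (hq : q ∉ T) :
    lambdaS G (insert q T) = lambdaS G T + 2 * (nbrS G T q).card := by
  have key : ((insert q T ×ˢ insert q T).filter (fun p => G.Adj p.1 p.2)) =
      ((T ×ˢ T).filter (fun p => G.Adj p.1 p.2)) ∪
        (((nbrS G T q).image (fun a => (q, a))) ∪ ((nbrS G T q).image (fun a => (a, q)))) := by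
    ext ⟨a, b⟩
    simp only [nbrS, mem_filter, mem_product, mem_insert, mem_union, mem_image, Prod.mk.injEq]
    constructor
    · rintro ⟨⟨rfl | ha, rfl | hb⟩, h⟩
      · exact absurd h (G.loopless.irrefl _)
      · exact Or.inr (Or.inl ⟨b, ⟨hb, h⟩, rfl, rfl⟩)
      · exact Or.inr (Or.inr ⟨a, ⟨ha, h.symm⟩, rfl, rfl⟩)
      · exact Or.inl ⟨⟨ha, hb⟩, h⟩
    · rintro (⟨⟨ha, hb⟩, h⟩ | ⟨c, ⟨hc, h⟩, rfl, rfl⟩ | ⟨c, ⟨hc, h⟩, rfl, rfl⟩)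
      · exact ⟨⟨Or.inr ha, Or.inr hb⟩, h⟩
      · exact ⟨⟨Or.inl rfl, Or.inr hc⟩, h⟩
      · exact ⟨⟨Or.inr hc, Or.inl rfl⟩, h.symm⟩
  unfold lambdaS
  rw [key, card_union_of_disjoint, card_union_of_disjoint, card_image_of_injective,
    card_image_of_injective]
  · ring
  · intro a b h; simpa using h
  · intro a b h; simpa using h
  · rw [disjoint_left]
    rintro ⟨a, b⟩ h1 h2
    simp only [nbrS, mem_filter, mem_image, Prod.mk.injEq] at h1 h2
    obtain ⟨c, ⟨hc, h⟩, rfl, rfl⟩ := h1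
    obtain ⟨d, ⟨hd, h'⟩, rfl, rfl⟩ := h2
    exact hq hc
  · rw [disjoint_left]
    rintro ⟨a, b⟩ h1 h2
    simp only [nbrS, mem_filter, mem_product, mem_union, mem_image, Prod.mk.injEq] at h1 h2
    obtain ⟨⟨ha, hb⟩, -⟩ := h1
    obtain ⟨c, ⟨hc, h⟩, rfl, rfl⟩ | ⟨c, ⟨hc, h⟩, rfl, rfl⟩ := h2
    · exact hq ha
    · exact hq hb

theorem no_D_pair_adjacent_to_D_pair_and_A_pair {V : Type*} [Fintype V] [DecidableEq V]
    (G : SimpleGraph V) [DecidableRel G.Adj] (S : Finset V) (m : V → V)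
    (hconn : G.Connected)
    (hcubic : ∀ v : V, G.degree v = 3)
    (hdom : ∀ v : V, v ∉ S → ∃ u ∈ S, G.Adj v u)
    (hmatch : IsMatchingOn G S m)
    (hmincard : ∀ T : Finset V, IsPDS G T → S.card ≤ T.card)
    (hP1 : ∀ T : Finset V, IsPDS G T → T.card = S.card → lambdaS G S ≤ lambdaS G T)
    (hP2 : ∀ (T : Finset V) (m' : V → V),
        (∀ v : V, v ∉ T → ∃ u ∈ T, G.Adj v u) → IsMatchingOn G T m' →
        T.card = S.card → lambdaS G T = lambdaS G S →
        (setA G S m ∪ setB G S m).card ≤ (setA G T m' ∪ setB G T m').card) :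
    ¬ ∃ u v w : V, IsDPair G S m u ∧ IsDPair G S m v ∧ IsAPair G S m w ∧
      v ≠ u ∧ v ≠ m u ∧ w ≠ u ∧ w ≠ m u ∧ w ≠ v ∧ w ≠ m v ∧
      G.Adj u v ∧ G.Adj u w := by
  rintro ⟨u, v, w, ⟨huD, -⟩, ⟨hvD, -⟩, ⟨hwA, -⟩, hvu, hvmu, hwu, hwmu, hwv, -, huv, huw⟩
  have hu : u ∈ S := (mem_filter.1 huD).1
  have hv : v ∈ S := (mem_filter.1 hvD).1
  have hw : w ∈ S := (mem_filter.1 hwA).1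
  have hpv : privates G S (m v) = ∅ := (mem_filter.1 hvD).2.2
  obtain ⟨hmu, hmune, hadju, hmmu⟩ := hmatch u hu
  obtain ⟨hmv, hmvne, hadjv, hmmv⟩ := hmatch v hv
  have humv : u ≠ m v := by
    intro h; apply hvmu; rw [h, hmmv]
  have hmumv : m u ≠ m v := by
    intro h; apply hvu; rw [← hmmv, ← h, hmmu]
  -- the neighbours of `u` are exactly `m u`, `v`, `w`
  have hcard3 : ({m u, v, w} : Finset V).card = 3 := by
    rw [card_eq_three]
    exact ⟨m u, v, w, hvmu.symm, hwmu.symm, hwv.symm, rfl⟩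
  have hNu : ({m u, v, w} : Finset V) = G.neighborFinset u := by
    apply eq_of_subset_of_card_le
    · intro a ha
      simp only [mem_insert, mem_singleton] at ha
      rw [SimpleGraph.mem_neighborFinset]
      rcases ha with rfl | rfl | rfl <;> assumption
    · rw [hcard3, SimpleGraph.card_neighborFinset_eq_degree, hcubic]
  have hNuS : ∀ a, G.Adj u a → a ∈ S := by
    intro a ha
    have : a ∈ ({m u, v, w} : Finset V) := by
      rw [hNu, SimpleGraph.mem_neighborFinset]; exact ha
    simp only [mem_insert, mem_singleton] at this
    rcases this with rfl | rfl | rfl <;> assumption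
  -- some vertex outside `S` has all its `S`-neighbours in `{m u, m v}`
  obtain ⟨q, hqS, hq⟩ : ∃ q, q ∉ S ∧ ∀ a ∈ S, G.Adj q a → a = m u ∨ a = m v := by
    by_contra hcon
    push Not at hcon
    have hle := hmincard ((S.erase (m u)).erase (m v)) ⟨?_, ?_⟩
    · have h1 : ((S.erase (m u)).erase (m v)).card < (S.erase (m u)).card :=
        card_erase_lt_of_mem (mem_erase.2 ⟨hmumv.symm, hmv⟩)
      have h2 := card_erase_lt_of_mem hmu
      omega
    · intro a ha
      by_cases haS : a ∈ S
      · by_cases h1 : a = m u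
        · exact ⟨u, by simp [hu, humv, hmune.symm], by rw [h1]; exact hadju.symm⟩
        · have h2 : a = m v := by
            by_contra h2
            exact ha (by simp [h1, h2, haS])
          exact ⟨v, by simp [hv, hvmu, hmvne.symm], by rw [h2]; exact hadjv.symm⟩
      · obtain ⟨b, hb, hab, h1, h2⟩ := hcon a haS
        exact ⟨b, by simp [h1, h2, hb], hab⟩
    · refine ⟨fun a => if a = u then v else if a = v then u else m a, ?_⟩
      intro a ha
      simp only [mem_erase] at ha
      obtain ⟨ha2, ha1, haS⟩ := ha
      by_cases hau : a = u
      · subst hau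
        simp [hvu, hv, hvmu, hmvne.symm, huv]
      by_cases hav : a = v
      · subst hav
        simp [hvu, hu, humv, hmune.symm, huv.symm, hvu.symm]
      obtain ⟨k1, k2, k3, k4⟩ := hmatch a haS
      have e1 : m a ≠ u := by intro h; apply ha1; rw [← h, k4]
      have e2 : m a ≠ v := by intro h; apply ha2; rw [← h, k4]
      have e3 : m a ≠ m u := by intro h; apply hau; rw [← k4, h, hmmu]
      have e4 : m a ≠ m v := by intro h; apply hav; rw [← k4, h, hmmv]
      simp [hau, hav, e1, e2, e3, e4, k1, k2, k3, k4]
  have hqu : G.Adj q (m u) := by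
    by_contra hno
    have : q ∈ privates G S (m v) := by
      refine mem_filter.2 ⟨mem_univ _, hqS, ?_⟩
      ext a
      simp only [nbrS, mem_filter, mem_singleton]
      have hall : ∀ a ∈ S, G.Adj q a → a = m v := by
        intro a ha h
        rcases hq a ha h with rfl | h'
        · exact absurd h hno
        · exact h'
      constructor
      · rintro ⟨ha, h⟩; exact hall a ha h
      · rintro rfl
        obtain ⟨b, hb, hqb⟩ := hdom q hqS
        rw [← hall b hb hqb]
        exact ⟨hb, hqb⟩
    rw [hpv] at this
    exact absurd this (notMem_empty _)
  -- swap `u` for `q`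
  have hqne : q ≠ u := by rintro rfl; exact hqS hu
  have hqmu : q ≠ m u := by rintro rfl; exact hqS hmu
  have hq0 : q ∉ S.erase u := fun h => hqS (mem_of_mem_erase h)
  have hP := hP1 (insert q (S.erase u)) ⟨?_, ?_⟩ ?_
  · have l1 := lambdaS_insert_aux G (S.erase u) q hq0
    have l2 := lambdaS_insert_aux G (S.erase u) u (notMem_erase u S)
    rw [insert_erase hu] at l2
    have c1 : (nbrS G (S.erase u) q).card ≤ 2 := by
      refine le_trans (card_le_card (t := {m u, m v}) ?_) card_le_two
      intro a ha
      simp only [nbrS, mem_filter, mem_erase] at ha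
      simpa using hq a ha.1.2 ha.2
    have c2 : 3 ≤ (nbrS G (S.erase u) u).card := by
      rw [← hcard3]
      apply card_le_card
      intro a ha
      have ha' : G.Adj u a := by
        rw [hNu, SimpleGraph.mem_neighborFinset] at ha; exact ha
      exact mem_filter.2 ⟨mem_erase.2 ⟨ha'.ne', hNuS a ha'⟩, ha'⟩
    omega
  · intro a ha
    by_cases hau : a = u
    · exact ⟨v, by simp [hv, hvu], by rw [hau]; exact huv⟩
    · have haS : a ∉ S := by
        intro h; exact ha (by simp [h, hau])
      obtain ⟨b, hb, hab⟩ := hdom a haS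
      have hbu : b ≠ u := by
        rintro rfl; exact haS (hNuS a hab.symm)
      exact ⟨b, by simp [hb, hbu], hab⟩
  · refine ⟨fun a => if a = q then m u else if a = m u then q else m a, ?_⟩
    intro a ha
    by_cases haq : a = q
    · subst haq
      simp [hmu, hmune, hqu, hqmu.symm]
    have haS : a ≠ u ∧ a ∈ S := by simpa [haq] using ha
    by_cases hamu : a = m u
    · subst hamu
      simp [hqmu, hqmu.symm, hqu.symm]
    obtain ⟨k1, k2, k3, k4⟩ := hmatch a haS.2
    have e1 : m a ≠ q := by intro h; apply hqS; rw [← h]; exact k1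
    have e2 : m a ≠ m u := by intro h; apply haS.1; rw [← k4, h, hmmu]
    have e3 : m a ≠ u := by intro h; apply hamu; rw [← h, k4]
    simp [haq, hamu, e1, e2, e3, k1, k2, k3, k4]
  · rw [card_insert_of_notMem hq0, card_erase_add_one hu]
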